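/- arXiv:2510.17798 — 2 statements merged into one kernel-verified Lean document; each statement's English description precedes it below -/
import Mathlib

section
/- Let A ∈ ℝ^{n×n} be invertible, let g, b ∈ ℝⁿ with g_l > 0 for all l, and set G := Aᵀ diag(g) A and B := Aᵀ diag(b) A. Then G is invertible, G + B G⁻¹ B = Aᵀ diag( ((g_l² + b_l²)/g_l)_l ) A, its inverse is (G + B G⁻¹ B)⁻¹ = A⁻¹ diag( (g_l/(g_l² + b_l²))_l ) A⁻ᵀ, and moreover −(G + B G⁻¹ B)⁻¹ B G⁻¹ = A⁻¹ diag( (−b_l/(g_l² + b_l²))_l ) A⁻ᵀ. -/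
open Matrix

/-- For an invertible (reduced incidence) matrix `A` and edge weights
with `g_l > 0`, the Schur-complement identities for the conductance and susceptance
Laplacians `G = Aᵀ diag(g) A`, `B = Aᵀ diag(b) A` hold in closed form. -/
theorem radial_schur_complement_identities {n : ℕ}
    (A : Matrix (Fin n) (Fin n) ℝ) (hA : IsUnit A.det)
    (g b : Fin n → ℝ) (hg : ∀ l, 0 < g l)
    (G B : Matrix (Fin n) (Fin n) ℝ)
    (hG : G = Aᵀ * Matrix.diagonal g * A)
    (hB : B = Aᵀ * Matrix.diagonal b * A) :
    IsUnit G.det ∧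
      G + B * G⁻¹ * B =
        Aᵀ * Matrix.diagonal (fun l => (g l ^ 2 + b l ^ 2) / g l) * A ∧
      (G + B * G⁻¹ * B)⁻¹ =
        A⁻¹ * Matrix.diagonal (fun l => g l / (g l ^ 2 + b l ^ 2)) * (Aᵀ)⁻¹ ∧
      -((G + B * G⁻¹ * B)⁻¹ * B * G⁻¹) =
        A⁻¹ * Matrix.diagonal (fun l => -(b l) / (g l ^ 2 + b l ^ 2)) * (Aᵀ)⁻¹ := by
  have hT : IsUnit (Aᵀ).det := by rwa [Matrix.det_transpose]
  have e1 : A * A⁻¹ = 1 := Matrix.mul_nonsing_inv A hA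
  have e2 : (Aᵀ)⁻¹ * Aᵀ = 1 := Matrix.nonsing_inv_mul _ hT
  have e3 : Aᵀ * (Aᵀ)⁻¹ = 1 := Matrix.mul_nonsing_inv _ hT
  generalize Aᵀ = P at *
  generalize (P)⁻¹ = R at *
  generalize A⁻¹ = Q at *
  -- products of congruences of diagonal matrices
  have mulPQ : ∀ c d : Fin n → ℝ, (P * diagonal c * A) * (Q * diagonal d * R)
      = P * diagonal (fun l => c l * d l) * R := by
    intro c d
    calc _ = P * diagonal c * (A * Q) * diagonal d * R := by simp only [Matrix.mul_assoc]
      _ = _ := by rw [e1, Matrix.mul_one, Matrix.mul_assoc P, diagonal_mul_diagonal]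
  have mulQP : ∀ c d : Fin n → ℝ, (Q * diagonal c * R) * (P * diagonal d * A)
      = Q * diagonal (fun l => c l * d l) * A := by
    intro c d
    calc _ = Q * diagonal c * (R * P) * diagonal d * A := by simp only [Matrix.mul_assoc]
      _ = _ := by rw [e2, Matrix.mul_one, Matrix.mul_assoc Q, diagonal_mul_diagonal]
  have mulRP : ∀ c d : Fin n → ℝ, (P * diagonal c * R) * (P * diagonal d * A)
      = P * diagonal (fun l => c l * d l) * A := by
    intro c d
    calc _ = P * diagonal c * (R * P) * diagonal d * A := by simp only [Matrix.mul_assoc]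
      _ = _ := by rw [e2, Matrix.mul_one, Matrix.mul_assoc P, diagonal_mul_diagonal]
  have mulAQ : ∀ c d : Fin n → ℝ, (Q * diagonal c * A) * (Q * diagonal d * R)
      = Q * diagonal (fun l => c l * d l) * R := by
    intro c d
    calc _ = Q * diagonal c * (A * Q) * diagonal d * R := by simp only [Matrix.mul_assoc]
      _ = _ := by rw [e1, Matrix.mul_one, Matrix.mul_assoc Q, diagonal_mul_diagonal]
  have key : ∀ c d : Fin n → ℝ, (∀ l, c l * d l = 1) →
      (P * diagonal c * A) * (Q * diagonal d * R) = 1 := by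
    intro c d h
    rw [mulPQ, funext h, diagonal_one, Matrix.mul_one, e3]
  have hg0 : ∀ l, g l ≠ 0 := fun l => (hg l).ne'
  have hs0 : ∀ l, g l ^ 2 + b l ^ 2 ≠ 0 := fun l => by
    have := hg l
    positivity
  have kG := key g (fun l => (g l)⁻¹) (fun l => mul_inv_cancel₀ (hg0 l))
  rw [← hG] at kG
  have iG : G⁻¹ = Q * diagonal (fun l => (g l)⁻¹) * R := Matrix.inv_eq_right_inv kG
  have hS : G + B * G⁻¹ * B = P * diagonal (fun l => (g l ^ 2 + b l ^ 2) / g l) * A := by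
    rw [iG, hB, hG, mulPQ, mulRP, ← Matrix.add_mul, ← Matrix.mul_add, diagonal_add]
    congr 3
    funext l
    have := hg0 l
    field_simp
  have iS : (G + B * G⁻¹ * B)⁻¹ = Q * diagonal (fun l => g l / (g l ^ 2 + b l ^ 2)) * R := by
    rw [hS]
    refine Matrix.inv_eq_right_inv (key _ _ fun l => ?_)
    have := hg0 l
    have := hs0 l
    field_simp
  refine ⟨Matrix.isUnit_det_of_right_inverse kG, hS, iS, ?_⟩
  rw [iS, iG, hB, mulQP, mulAQ, ← Matrix.neg_mul, ← Matrix.mul_neg, diagonal_neg]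
  congr 3
  funext l
  have := hg0 l
  have := hs0 l
  field_simp
end

section
/- Let A ∈ ℝ^{n×n} be invertible, let g, b ∈ ℝⁿ with g_l > 0 for all l, and set G := Aᵀ diag(g) A, B := Aᵀ diag(b) A, r_l := g_l/(g_l² + b_l²), x_l := −b_l/(g_l² + b_l²), R := A⁻¹ diag(r) A⁻ᵀ, and X := A⁻¹ diag(x) A⁻ᵀ. Then the 2n×2n block matrix M := [[G, −B], [−B, −G]] is invertible with inverse M⁻¹ = [[R, X], [X, −R]]; equivalently, [[G, −B], [−B, −G]] · [[R, X], [X, −R]] = I_{2n}. -/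
open Matrix

/-- For a radial network with invertible reduced incidence matrix `A`,
the linear coupled power flow matrix `M = [[G, −B], [−B, −G]]` is invertible with inverse
`[[R, X], [X, −R]]`, where `R` and `X` are the resistance and reactance matrices. -/
theorem lcpf_block_inverse {n : ℕ}
    (A : Matrix (Fin n) (Fin n) ℝ) (hA : IsUnit A.det)
    (g b : Fin n → ℝ) (hg : ∀ l, 0 < g l)
    (G B : Matrix (Fin n) (Fin n) ℝ)
    (hG : G = Aᵀ * Matrix.diagonal g * A)
    (hB : B = Aᵀ * Matrix.diagonal b * A)
    (r x : Fin n → ℝ)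
    (hr : ∀ l, r l = g l / (g l ^ 2 + b l ^ 2))
    (hx : ∀ l, x l = -(b l) / (g l ^ 2 + b l ^ 2))
    (R X : Matrix (Fin n) (Fin n) ℝ)
    (hR : R = A⁻¹ * Matrix.diagonal r * (Aᵀ)⁻¹)
    (hX : X = A⁻¹ * Matrix.diagonal x * (Aᵀ)⁻¹)
    (M : Matrix (Fin n ⊕ Fin n) (Fin n ⊕ Fin n) ℝ)
    (hM : M = Matrix.fromBlocks G (-B) (-B) (-G)) :
    IsUnit M.det ∧
      M * Matrix.fromBlocks R X X (-R) = 1 ∧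
      M⁻¹ = Matrix.fromBlocks R X X (-R) := by
  have hAT : IsUnit (Aᵀ).det := by rwa [Matrix.det_transpose]
  have key : ∀ p q : Fin n → ℝ,
      (Aᵀ * Matrix.diagonal p * A) * (A⁻¹ * Matrix.diagonal q * (Aᵀ)⁻¹)
        = Aᵀ * Matrix.diagonal (fun l => p l * q l) * (Aᵀ)⁻¹ := by
    intro p q
    rw [← Matrix.diagonal_mul_diagonal]
    simp only [Matrix.mul_assoc]
    rw [Matrix.mul_nonsing_inv_cancel_left A _ hA]
  have hne : ∀ l, g l ^ 2 + b l ^ 2 ≠ 0 := fun l => by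
    have := hg l
    positivity
  have h1 : G * R - B * X = 1 := by
    rw [hG, hB, hR, hX, key, key, ← Matrix.sub_mul, ← Matrix.mul_sub, Matrix.diagonal_sub]
    have : (fun l => g l * r l - b l * x l) = fun _ => (1 : ℝ) := by
      funext l
      have := hne l
      rw [hr, hx]
      field_simp
      ring
    rw [this, Matrix.diagonal_one, Matrix.mul_one, Matrix.mul_nonsing_inv _ hAT]
  have h2 : G * X + B * R = 0 := by
    rw [hG, hB, hR, hX, key, key, ← Matrix.add_mul, ← Matrix.mul_add, Matrix.diagonal_add]
    have : (fun l => g l * x l + b l * r l) = fun _ => (0 : ℝ) := by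
      funext l
      rw [hr, hx]
      ring
    rw [this, Matrix.diagonal_zero, Matrix.mul_zero, Matrix.zero_mul]
  have hmul : M * Matrix.fromBlocks R X X (-R) = 1 := by
    rw [hM, Matrix.fromBlocks_multiply, ← Matrix.fromBlocks_one]
    congr 1
    · rw [← h1, Matrix.neg_mul, sub_eq_add_neg]
    · rw [← h2, neg_mul_neg]
    · rw [← neg_zero, ← h2, Matrix.neg_mul, Matrix.neg_mul]
      abel
    · rw [← h1, neg_mul_neg, Matrix.neg_mul]
      abel
  exact ⟨Matrix.isUnit_det_of_right_inverse hmul, hmul, Matrix.inv_eq_right_inv hmul⟩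
end
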